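/- There exists an MSO₁ graph interpretation I=(ν,μ) and a polynomial p such that for every finite simple graph G with at least 4 vertices there exists a finite unit interval graph H (i.e., a {1}-interval graph) with at most p(|V(G)|) vertices such that I(H) is isomorphic to G. In particular, the class of all finite graphs has a polynomially bounded simple MSO₁ interpretation in the class of unit interval graphs. -/

import Mathlib

/-- `ℓ, r` form an interval representation of the simple graph `G`: the vertex `v` is
represented by the half-open interval `[ℓ v, r v)` and two distinct vertices are
adjacent iff their intervals intersect. -/
structure IsIntervalRep {V : Type} (G : SimpleGraph V) (ℓ r : V → ℝ) : Prop where
  lt : ∀ v, ℓ v < r v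
  adj : ∀ u v : V, u ≠ v →
    (G.Adj u v ↔ (Set.Ico (ℓ u) (r u) ∩ Set.Ico (ℓ v) (r v)).Nonempty)

/-- MSO₁ formulas about graphs, with vertex variables and vertex-set variables indexed
by natural numbers: atomic formulas for adjacency, equality of vertices and membership
of a vertex in a set, closed under (an adequate set of) boolean connectives and under
quantification over vertices and vertex sets. -/
inductive MSO : Type where
  | adj (i j : ℕ) : MSO
  | eq (i j : ℕ) : MSO
  | mem (i X : ℕ) : MSO
  | fls : MSO
  | imp (φ ψ : MSO) : MSO
  | vAll (i : ℕ) (φ : MSO) : MSO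
  | sAll (X : ℕ) (φ : MSO) : MSO

/-- Satisfaction of an MSO₁ formula in a graph `G` under an assignment `a` of vertices
to the vertex variables and an assignment `A` of vertex sets to the set variables. -/
def MSO.Realize {V : Type} (G : SimpleGraph V) :
    MSO → (ℕ → V) → (ℕ → Set V) → Prop
  | .adj i j, a, _ => G.Adj (a i) (a j)
  | .eq i j, a, _ => a i = a j
  | .mem i X, a, A => a i ∈ A X
  | .fls, _, _ => False
  | .imp φ ψ, a, A => φ.Realize G a A → ψ.Realize G a A
  | .vAll i φ, a, A => ∀ v : V, φ.Realize G (Function.update a i v) A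
  | .sAll X φ, a, A => ∀ S : Set V, φ.Realize G a (Function.update A X S)

/-- `φ` has the single free vertex variable `0` (and no free set variables): its truth
value depends only on the value assigned to the vertex variable `0`. -/
def MSO.FreeVar0 (φ : MSO) : Prop :=
  ∀ (V : Type) (G : SimpleGraph V) (a a' : ℕ → V) (A A' : ℕ → Set V),
    a 0 = a' 0 → (φ.Realize G a A ↔ φ.Realize G a' A')

/-- `φ` has exactly the two free vertex variables `0` and `1` (and no free set
variables): its truth value depends only on the values assigned to the vertex
variables `0` and `1`. -/
def MSO.FreeVar01 (φ : MSO) : Prop :=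
  ∀ (V : Type) (G : SimpleGraph V) (a a' : ℕ → V) (A A' : ℕ → Set V),
    a 0 = a' 0 → a 1 = a' 1 → (φ.Realize G a A ↔ φ.Realize G a' A')

/-- The assignment sending the vertex variable `0` to `x` and all other vertex
variables to `y`; it is used to evaluate formulas with free variables `0` and `1`. -/
def assign2 {V : Type} (x y : V) : ℕ → V := fun i => if i = 0 then x else y

/-- `μ` is symmetric: `H ⊨ μ(x,y) ↔ μ(y,x)` holds in every graph `H`. -/
def MSO.Symm (μ : MSO) : Prop :=
  ∀ (V : Type) (H : SimpleGraph V) (x y : V),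
    μ.Realize H (assign2 x y) (fun _ => ∅) ↔ μ.Realize H (assign2 y x) (fun _ => ∅)

/-- The graph `I(H)` obtained by applying the MSO₁ graph interpretation `I = (ν, μ)` to
`H`: its vertices are the vertices `v` of `H` satisfying `ν(v)` and its edges are the
pairs `{u, v}` of distinct vertices satisfying `μ(u, v)` (for symmetric `μ`, the
symmetrization performed by `SimpleGraph.fromRel` does not change the edge set). -/
def msoInterpGraph {W : Type} (H : SimpleGraph W) (ν μ : MSO) :
    SimpleGraph {w : W // ν.Realize H (fun _ => w) (fun _ => ∅)} :=
  SimpleGraph.fromRel (fun u v => μ.Realize H (assign2 u.1 v.1) (fun _ => ∅))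

namespace MSO

/-- Negation. -/
def neg (φ : MSO) : MSO := .imp φ .fls

/-- Conjunction. -/
def and (φ ψ : MSO) : MSO := neg (.imp φ (neg ψ))

/-- Disjunction. -/
def or (φ ψ : MSO) : MSO := .imp (neg φ) ψ

/-- Existential quantification over a vertex. -/
def vEx (i : ℕ) (φ : MSO) : MSO := neg (.vAll i (neg φ))

section Realize

variable {V : Type} {G : SimpleGraph V} {a : ℕ → V} {A : ℕ → Set V} {φ ψ : MSO}

theorem realize_neg : (neg φ).Realize G a A ↔ ¬ φ.Realize G a A := Iff.rfl

theorem realize_and : (and φ ψ).Realize G a A ↔ φ.Realize G a A ∧ ψ.Realize G a A := by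
  simp only [and, neg, Realize]; tauto

theorem realize_or : (or φ ψ).Realize G a A ↔ φ.Realize G a A ∨ ψ.Realize G a A := by
  simp only [or, neg, Realize]; tauto

theorem realize_vEx {i : ℕ} :
    (vEx i φ).Realize G a A ↔ ∃ v, φ.Realize G (Function.update a i v) A := by
  simp only [vEx, neg, Realize]
  exact not_forall_not

end Realize

/-- The formula expressing that `i` and `j` are equal or adjacent. -/
def near (i j : ℕ) : MSO := or (.eq i j) (.adj i j)

/-- The formula expressing that `i` and `j` have the same closed neighbourhood. -/
def twin (i j : ℕ) : MSO :=
  .vAll 10 (and (.imp (near i 10) (near j 10)) (.imp (near j 10) (near i 10)))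

/-- The formula expressing that, up to twins, `i` is the only element of `N[w] \ N[j]` for
some vertex `w`. -/
def link (i j : ℕ) : MSO :=
  vEx 8 (and (near 8 i) (and (neg (near j i))
    (.vAll 9 (.imp (near 8 9) (.imp (neg (near j 9)) (twin 9 i))))))

/-- The formula expressing that `j` lies in every set containing `i` and closed under
`MSO.link`. -/
def reach (i j : ℕ) : MSO :=
  .sAll 0 (.imp (.mem i 0)
    (.imp (.vAll 6 (.vAll 7 (.imp (.mem 6 0) (.imp (link 6 7) (.mem 7 0))))) (.mem j 0)))

/-- The formula expressing that `i` has at least two further twins. -/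
def marked (i : ℕ) : MSO :=
  vEx 4 (vEx 5 (and (twin i 4) (and (twin i 5)
    (and (neg (.eq i 4)) (and (neg (.eq i 5)) (neg (.eq 4 5)))))))

/-- The vertex formula of the interpretation: `0` has no twin. -/
def vertexFormula : MSO := .vAll 1 (.imp (twin 0 1) (.eq 0 1))

/-- The edge formula of the interpretation: adjacent marked vertices are reachable from
`0` and `1`. -/
def edgeFormula : MSO :=
  vEx 2 (vEx 3 (and (.adj 2 3) (and (marked 2) (and (marked 3) (and (reach 0 2) (reach 1 3))))))

end MSO

namespace SimpleGraph

section Defs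

variable {V : Type} (G : SimpleGraph V)

/-- Two vertices are equal or adjacent. -/
def Near (x y : V) : Prop := x = y ∨ G.Adj x y

/-- Two vertices have the same closed neighbourhood. -/
def Twin (x y : V) : Prop := ∀ z, G.Near x z ↔ G.Near y z

/-- Up to twins, `x` is the only element of `N[w] \ N[y]` for some `w`. -/
def Link (x y : V) : Prop :=
  ∃ w, G.Near w x ∧ ¬ G.Near y x ∧ ∀ z, G.Near w z → ¬ G.Near y z → G.Twin z x

/-- `y` lies in every set containing `x` and closed under `SimpleGraph.Link`. -/
def LinkReach (x y : V) : Prop :=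
  ∀ S : Set V, x ∈ S → (∀ u v, u ∈ S → G.Link u v → v ∈ S) → y ∈ S

/-- `x` has at least two further twins. -/
def HasTwoTwins (x : V) : Prop :=
  ∃ y z, G.Twin x y ∧ G.Twin x z ∧ x ≠ y ∧ x ≠ z ∧ y ≠ z

/-- `x` has no twin other than itself. -/
def TwinFree (x : V) : Prop := ∀ y, G.Twin x y → x = y

/-- The relation defined by `MSO.edgeFormula`. -/
def EdgeRel (x y : V) : Prop :=
  ∃ u v, G.Adj u v ∧ G.HasTwoTwins u ∧ G.HasTwoTwins v ∧ G.LinkReach x u ∧ G.LinkReach y v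

theorem edgeRel_comm (x y : V) : G.EdgeRel x y ↔ G.EdgeRel y x := by
  constructor <;> exact fun ⟨u, v, h, hu, hv, hx, hy⟩ => ⟨v, u, h.symm, hv, hu, hy, hx⟩

end Defs

end SimpleGraph

namespace MSO

section Semantics

variable {V : Type} {G : SimpleGraph V} {a : ℕ → V} {A : ℕ → Set V}

theorem realize_near {i j : ℕ} : (near i j).Realize G a A ↔ G.Near (a i) (a j) :=
  realize_or

theorem realize_twin {i j : ℕ} (hi : i ≠ 10) (hj : j ≠ 10) :
    (twin i j).Realize G a A ↔ G.Twin (a i) (a j) := by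
  simp only [twin, Realize, realize_and, realize_near, SimpleGraph.Twin, iff_iff_implies_and_implies,
    Function.update_self, Function.update_of_ne hi, Function.update_of_ne hj]

theorem realize_link {i j : ℕ} (hi : i < 8) (hj : j < 8) :
    (link i j).Realize G a A ↔ G.Link (a i) (a j) := by
  have hi8 : i ≠ 8 := by omega
  have hi9 : i ≠ 9 := by omega
  have hi10 : i ≠ 10 := by omega
  have hj8 : j ≠ 8 := by omega
  have hj9 : j ≠ 9 := by omega
  simp [link, Realize, realize_vEx, realize_and, realize_neg, realize_near, realize_twin,
    SimpleGraph.Link, hi8, hi9, hi10, hj8, hj9]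

theorem realize_reach {i j : ℕ} :
    (reach i j).Realize G a A ↔ G.LinkReach (a i) (a j) := by
  simp [reach, Realize, realize_link, SimpleGraph.LinkReach]

theorem realize_marked {i : ℕ} (hi : i < 4) :
    (marked i).Realize G a A ↔ G.HasTwoTwins (a i) := by
  have hi4 : i ≠ 4 := by omega
  have hi5 : i ≠ 5 := by omega
  have hi10 : i ≠ 10 := by omega
  simp [marked, Realize, realize_vEx, realize_and, realize_neg, realize_twin,
    SimpleGraph.HasTwoTwins, hi4, hi5, hi10]

theorem realize_vertexFormula : vertexFormula.Realize G a A ↔ G.TwinFree (a 0) := by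
  simp [vertexFormula, Realize, realize_twin, SimpleGraph.TwinFree]

theorem realize_edgeFormula : edgeFormula.Realize G a A ↔ G.EdgeRel (a 0) (a 1) := by
  simp [edgeFormula, Realize, realize_vEx, realize_and, realize_marked, realize_reach,
    SimpleGraph.EdgeRel]

theorem vertexFormula_freeVar0 : vertexFormula.FreeVar0 := fun V G a a' A A' h => by
  rw [realize_vertexFormula, realize_vertexFormula, h]

theorem edgeFormula_freeVar01 : edgeFormula.FreeVar01 := fun V G a a' A A' h0 h1 => by
  rw [realize_edgeFormula, realize_edgeFormula, h0, h1]

theorem edgeFormula_symm : edgeFormula.Symm := fun V H x y => by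
  rw [realize_edgeFormula, realize_edgeFormula]
  exact H.edgeRel_comm x y

end Semantics

end MSO

/-- `H` is the `(n - 1)`-st power of a path on `M` positions, with every position `pos x`
replaced by a nonempty clique of twins. -/
structure IsPathPower {W : Type} (H : SimpleGraph W) (n M : ℕ) (pos : W → ℕ) : Prop where
  two_le : 2 ≤ n
  two_mul_le : 2 * n ≤ M
  pos_lt : ∀ x, pos x < M
  exists_pos : ∀ s < M, ∃ x, pos x = s
  adj : ∀ x y, H.Adj x y ↔ x ≠ y ∧ pos x < pos y + n ∧ pos y < pos x + n

namespace IsPathPower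

variable {W : Type} {H : SimpleGraph W} {n M : ℕ} {pos : W → ℕ}

theorem near_iff (h : IsPathPower H n M pos) (x y : W) :
    H.Near x y ↔ pos x < pos y + n ∧ pos y < pos x + n := by
  have := h.two_le
  by_cases hxy : x = y
  · subst hxy
    simp only [SimpleGraph.Near, true_or, true_iff]
    omega
  · simp [SimpleGraph.Near, h.adj, hxy]

theorem pos_le_of_twin (h : IsPathPower H n M pos) {x y : W} (hxy : H.Twin x y) :
    pos y ≤ pos x := by
  by_contra! hlt
  have h2 := h.two_le
  have hM := h.two_mul_le
  have hy := h.pos_lt y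
  by_cases hc : pos y + n - 1 < M
  · obtain ⟨z, hz⟩ := h.exists_pos _ hc
    have := hxy z
    rw [h.near_iff, h.near_iff] at this
    omega
  · obtain ⟨z, hz⟩ := h.exists_pos (pos x + 1 - n) (by omega)
    have := hxy z
    rw [h.near_iff, h.near_iff] at this
    omega

theorem twin_iff (h : IsPathPower H n M pos) (x y : W) : H.Twin x y ↔ pos x = pos y := by
  refine ⟨fun hxy => le_antisymm (h.pos_le_of_twin fun z => (hxy z).symm) (h.pos_le_of_twin hxy),
    fun hxy z => ?_⟩
  rw [h.near_iff, h.near_iff, hxy]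

theorem link_iff (h : IsPathPower H n M pos) (x y : W) :
    H.Link x y ↔ pos x = pos y + n ∨ pos y = pos x + n := by
  have h2 := h.two_le
  have hM := h.two_mul_le
  have hx := h.pos_lt x
  have hy := h.pos_lt y
  simp only [SimpleGraph.Link, h.near_iff, h.twin_iff]
  constructor
  · rintro ⟨w, hwx, hyx, hw⟩
    have key : ∀ s < M, pos w < s + n → s < pos w + n → ¬ (pos y < s + n ∧ s < pos y + n) →
        s = pos x := by
      intro s hs h1 h2 h3
      obtain ⟨z, rfl⟩ := h.exists_pos s hs
      exact hw z ⟨h1, h2⟩ h3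
    have hwM := h.pos_lt w
    rcases le_total (pos w) (pos y) with hwy | hwy
    · by_cases hc : pos w < pos y - n + n ∧ pos y - n < pos w + n
      · have := key (pos y - n) (by omega)
        omega
      · have := key (pos w) (by omega)
        have := key (pos w + 1) (by omega)
        omega
    · by_cases hc : pos y + n < M ∧ pos w < pos y + n + n
      · have := key (pos y + n) (by omega)
        omega
      · have := key (pos w) (by omega)
        have := key (pos w - 1) (by omega)
        omega
  · rintro (hxy | hxy)
    · obtain ⟨w, hw⟩ := h.exists_pos (pos y + 1) (by omega)
      exact ⟨w, by omega, by omega, fun z => by omega⟩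
    · obtain ⟨w, hw⟩ := h.exists_pos (pos y - 1) (by omega)
      exact ⟨w, by omega, by omega, fun z => by omega⟩

theorem linkReach_mod (h : IsPathPower H n M pos) {x y : W} (hxy : H.LinkReach x y) :
    pos y % n = pos x % n := by
  refine hxy {z | pos z % n = pos x % n} rfl fun u v hu huv => ?_
  rcases (h.link_iff u v).1 huv with huv | huv
  · simpa [huv] using hu
  · simpa [huv] using hu

theorem linkReach_of_pos_eq (h : IsPathPower H n M pos) {x : W} (k : ℕ) {y : W}
    (hy : pos y = pos x + (k + 1) * n) : H.LinkReach x y := by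
  intro S hx hS
  induction k generalizing y with
  | zero => exact hS x y hx ((h.link_iff x y).2 (by omega))
  | succ k ih =>
    have hlt := h.pos_lt y
    have hmul : (k + 1 + 1) * n = (k + 1) * n + n := by ring
    obtain ⟨z, hz⟩ := h.exists_pos (pos x + (k + 1) * n) (by omega)
    exact hS z y (ih hz) ((h.link_iff z y).2 (by omega))

end IsPathPower

section Encoding

variable {V : Type} {n : ℕ}

/-- The positions encoding the edges of `G`: the block of `n` positions numbered
`2 (u n + v + 1)` encodes the pair `(u, v)`. -/
def EdgeMark (G : SimpleGraph V) (e : V ≃ Fin n) (s : ℕ) : Prop :=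
  ∃ u v, G.Adj u v ∧ s / n = 2 * ((e u : ℕ) * n + e v + 1) ∧ (s % n = e u ∨ s % n = e v)

theorem EdgeMark.le {G : SimpleGraph V} {e : V ≃ Fin n} {s : ℕ} (h : EdgeMark G e s) : n ≤ s := by
  obtain ⟨u, v, -, h, -⟩ := h
  by_contra! hs
  rw [Nat.div_eq_of_lt hs] at h
  omega

theorem EdgeMark.adj {G : SimpleGraph V} {e : V ≃ Fin n} {s t : ℕ} (hs : EdgeMark G e s)
    (ht : EdgeMark G e t) (hst : s < t + n) (hts : t < s + n) {x y : V} (hx : s % n = e x)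
    (hy : t % n = e y) (hxy : x ≠ y) : G.Adj x y := by
  obtain ⟨u, v, huv, hsb, hsr⟩ := hs
  obtain ⟨u', v', huv', htb, htr⟩ := ht
  have hn : 0 < n := (e u).pos
  have h1 : s / n ≤ t / n + 1 := by
    rw [← Nat.add_div_right _ hn]; exact Nat.div_le_div_right hst.le
  have h2 : t / n ≤ s / n + 1 := by
    rw [← Nat.add_div_right _ hn]; exact Nat.div_le_div_right hts.le
  have h3 : (e u : ℕ) * n + e v = (e u' : ℕ) * n + e v' := by omega
  have hv : (e v : ℕ) = e v' := by
    have := congrArg (· % n) h3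
    simpa [Nat.mul_add_mod', Nat.mod_eq_of_lt] using this
  have hu : (e u : ℕ) = e u' := Nat.eq_of_mul_eq_mul_right hn (by omega)
  obtain rfl : u = u' := e.injective (Fin.ext hu)
  obtain rfl : v = v' := e.injective (Fin.ext hv)
  have inj : ∀ {a b : V}, (e a : ℕ) = e b → a = b := fun h => e.injective (Fin.ext h)
  rcases hsr with hsr | hsr <;> rcases htr with htr | htr <;>
    obtain rfl := inj (hx.symm.trans hsr) <;> obtain rfl := inj (hy.symm.trans htr)
  · exact absurd rfl hxy
  · exact huv
  · exact huv.symm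
  · exact absurd rfl hxy

theorem nonempty_iso_msoInterpGraph {W : Type} {H : SimpleGraph W} {pos : W → ℕ}
    (G : SimpleGraph V) (e : V ≃ Fin n) (h : IsPathPower H n (n * (2 * n ^ 2 + 1)) pos)
    (hfree : ∀ x, (∀ y, pos x = pos y → x = y) ↔ pos x < n)
    (hmark : ∀ x, (∃ y z, pos x = pos y ∧ pos x = pos z ∧ x ≠ y ∧ x ≠ z ∧ y ≠ z) ↔
      EdgeMark G e (pos x)) :
    Nonempty (G ≃g msoInterpGraph H MSO.vertexFormula MSO.edgeFormula) := by
  have hfree' : ∀ x, H.TwinFree x ↔ pos x < n := fun x => by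
    simp only [SimpleGraph.TwinFree, h.twin_iff, hfree]
  have hmark' : ∀ x, H.HasTwoTwins x ↔ EdgeMark G e (pos x) := fun x => by
    simp only [SimpleGraph.HasTwoTwins, h.twin_iff, hmark]
  have hn : 0 < n := by have := h.two_le; omega
  have hle := h.two_mul_le
  choose g hg using fun v : V => h.exists_pos (e v) (by have := (e v).isLt; omega)
  have hgfree : ∀ v, MSO.vertexFormula.Realize H (fun _ => g v) (fun _ => ∅) := fun v => by
    rw [MSO.realize_vertexFormula, hfree', hg]
    exact (e v).isLt
  have hbij : Function.Bijective fun v : V => (⟨g v, hgfree v⟩ :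
      {w : W // MSO.vertexFormula.Realize H (fun _ => w) (fun _ => ∅)}) := by
    constructor
    · intro u v huv
      have := congrArg (fun w => pos w.1) huv
      simp only [hg] at this
      exact e.injective (Fin.ext this)
    · rintro ⟨w, hw⟩
      rw [MSO.realize_vertexFormula, hfree'] at hw
      refine ⟨e.symm ⟨pos w, hw⟩, Subtype.ext ?_⟩
      exact ((hfree w).2 hw _ (by simp [hg])).symm
  have key : ∀ u v, u ≠ v → (H.EdgeRel (g u) (g v) ↔ G.Adj u v) := by
    intro u v huv
    constructor
    · rintro ⟨x, y, hxy, hx, hy, hux, hvy⟩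
      rw [hmark'] at hx hy
      have hxy := ((h.adj x y).1 hxy).2
      refine hx.adj hy hxy.1 hxy.2 ?_ ?_ huv
      · rw [h.linkReach_mod hux, hg, Nat.mod_eq_of_lt (e u).isLt]
      · rw [h.linkReach_mod hvy, hg, Nat.mod_eq_of_lt (e v).isLt]
    · intro hadj
      set c := (e u : ℕ) * n + e v with hc
      have hcn : c + 1 ≤ n ^ 2 := by
        have hu := (e u).isLt
        have hv := (e v).isLt
        nlinarith
      have hblock : ∀ i < n, i + (2 * c + 1 + 1) * n < n * (2 * n ^ 2 + 1) := by
        intro i hi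
        nlinarith [Nat.mul_le_mul_right n hcn]
      obtain ⟨x, hx⟩ := h.exists_pos _ (hblock _ (e u).isLt)
      obtain ⟨y, hy⟩ := h.exists_pos _ (hblock _ (e v).isLt)
      have hdiv : ∀ i < n, (i + (2 * c + 1 + 1) * n) / n = 2 * (c + 1) := by
        intro i hi
        rw [Nat.add_mul_div_right _ _ hn, Nat.div_eq_of_lt hi]
        ring
      have hmod : ∀ i < n, (i + (2 * c + 1 + 1) * n) % n = i := by
        intro i hi
        rw [Nat.add_mul_mod_self_right, Nat.mod_eq_of_lt hi]
      have hne : x ≠ y := by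
        rintro rfl
        exact huv (e.injective (Fin.ext (by omega)))
      refine ⟨x, y, (h.adj x y).2 ⟨hne, ?_, ?_⟩, (hmark' x).2 ?_, (hmark' y).2 ?_,
        h.linkReach_of_pos_eq (2 * c + 1) (by rw [hx, hg]),
        h.linkReach_of_pos_eq (2 * c + 1) (by rw [hy, hg])⟩
      · have := (e u).isLt; omega
      · have := (e v).isLt; omega
      · rw [hx]
        exact ⟨u, v, hadj, hdiv _ (e u).isLt, Or.inl (hmod _ (e u).isLt)⟩
      · rw [hy]
        exact ⟨u, v, hadj, hdiv _ (e v).isLt, Or.inr (hmod _ (e v).isLt)⟩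
  refine ⟨⟨Equiv.ofBijective _ hbij, fun {u v} => ?_⟩⟩
  have hinj : (⟨g u, hgfree u⟩ : {w : W // MSO.vertexFormula.Realize H (fun _ => w)
      (fun _ => ∅)}) ≠ ⟨g v, hgfree v⟩ ↔ u ≠ v := hbij.1.ne_iff
  simp only [msoInterpGraph, Equiv.ofBijective_apply, SimpleGraph.fromRel_adj, hinj,
    MSO.realize_edgeFormula]
  simp only [assign2, if_true, one_ne_zero, if_false]
  rw [H.edgeRel_comm (g v), or_self]
  exact ⟨fun ⟨hne, hr⟩ => (key u v hne).1 hr, fun ha => ⟨ha.ne, (key u v ha.ne).2 ha⟩⟩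

end Encoding

/-- The graph on `W` joining distinct vertices whose positions differ by less than `n`. -/
def proximityGraph {W : Type} (n : ℕ) (pos : W → ℕ) : SimpleGraph W where
  Adj x y := x ≠ y ∧ pos x < pos y + n ∧ pos y < pos x + n
  symm := ⟨fun _ _ h => ⟨h.1.symm, h.2.2, h.2.1⟩⟩
  loopless := ⟨fun _ h => h.1 rfl⟩

theorem proximityGraph_isIntervalRep {W : Type} {n : ℕ} (hn : 0 < n) (pos : W → ℕ) :
    IsIntervalRep (proximityGraph n pos) (fun x => (pos x : ℝ) / n)
      (fun x => (pos x : ℝ) / n + 1) := by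
  have hn' : (0 : ℝ) < n := by exact_mod_cast hn
  have key : ∀ a b : ℕ, ((a : ℝ) / n < b / n + 1 ↔ a < b + n) := fun a b => by
    rw [div_add_one hn'.ne', div_lt_div_iff_of_pos_right hn']
    exact_mod_cast Iff.rfl
  refine ⟨fun v => lt_add_one _, fun u v huv => ?_⟩
  simp only [Set.Ico_inter_Ico, Set.nonempty_Ico, sup_lt_iff, lt_inf_iff, key]
  simp only [proximityGraph, ne_eq, huv, not_false_eq_true, true_and]
  omega

/-- There is a finite family of positions realizing prescribed multiplicities: positions below
`n` occur once, positions satisfying `P` at least three times, and all others twice. -/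
theorem exists_positions (n M : ℕ) (P : ℕ → Prop) (hP : ∀ s, P s → n ≤ s) :
    ∃ N ≤ M * 3, ∃ pos : Fin N → ℕ, (∀ x, pos x < M) ∧ (∀ s < M, ∃ x, pos x = s) ∧
      (∀ x, (∀ y, pos x = pos y → x = y) ↔ pos x < n) ∧
      ∀ x, (∃ y z, pos x = pos y ∧ pos x = pos z ∧ x ≠ y ∧ x ≠ z ∧ y ≠ z) ↔ P (pos x) := by
  classical
  let Q : Fin M × Fin 3 → Prop := fun p =>
    p.2 = 0 ∨ (p.2 = 1 ∧ n ≤ (p.1 : ℕ)) ∨ (p.2 = 2 ∧ P p.1)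
  let E : Fin (Fintype.card {p // Q p}) ≃ {p // Q p} := (Fintype.equivFin _).symm
  have ext : ∀ x y, ((E x).1.1 : ℕ) = (E y).1.1 → (E x).1.2 = (E y).1.2 → x = y :=
    fun x y h1 h2 => E.injective (Subtype.ext (Prod.ext (Fin.ext h1) h2))
  have mk : ∀ (s : Fin M) (k : Fin 3), Q (s, k) → ∃ x, ((E x).1.1 : ℕ) = s ∧ (E x).1.2 = k :=
    fun s k h => ⟨E.symm ⟨(s, k), h⟩, by simp, by simp⟩
  refine ⟨_, ?_, fun x => (E x).1.1, fun x => (E x).1.1.isLt, fun s hs => ?_, fun x => ?_,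
    fun x => ?_⟩
  · exact (Fintype.card_subtype_le Q).trans (by simp)
  · obtain ⟨x, hx, -⟩ := mk ⟨s, hs⟩ 0 (Or.inl rfl)
    exact ⟨x, hx⟩
  · constructor
    · intro hx
      by_contra! hn
      obtain ⟨y, hy, hy'⟩ := mk (E x).1.1 0 (Or.inl rfl)
      obtain ⟨z, hz, hz'⟩ := mk (E x).1.1 1 (Or.inr (Or.inl ⟨rfl, hn⟩))
      have := hx y hy.symm
      have := hx z hz.symm
      simp_all
    · intro hx y hxy
      have zero : ∀ w, ((E w).1.1 : ℕ) < n → (E w).1.2 = 0 := by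
        intro w hw
        rcases (E w).2 with h | h | h
        · exact h
        · exact absurd h.2 hw.not_ge
        · exact absurd (hP _ h.2) hw.not_ge
      exact ext x y hxy ((zero x hx).trans (zero y (hxy.symm.trans_lt hx)).symm)
  · constructor
    · rintro ⟨y, z, hxy, hxz, nxy, nxz, nyz⟩
      have two : ∀ w, ((E x).1.1 : ℕ) = (E w).1.1 → (E w).1.2 = 2 → P (E x).1.1 := by
        intro w hw h2
        rcases (E w).2 with h | h | h
        · rw [h] at h2; exact absurd h2 (by decide)
        · rw [h.1] at h2; exact absurd h2 (by decide)
        · rw [hw]; exact h.2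
      have dxy := mt (ext x y hxy) nxy
      have dxz := mt (ext x z hxz) nxz
      have dyz := mt (ext y z (hxy.symm.trans hxz)) nyz
      have pigeon : ∀ i j k : Fin 3, i ≠ j → i ≠ k → j ≠ k → i = 2 ∨ j = 2 ∨ k = 2 := by decide
      rcases pigeon _ _ _ dxy dxz dyz with h | h | h
      · exact two x rfl h
      · exact two y hxy h
      · exact two z hxz h
    · intro hx
      have mem : ∀ k : Fin 3, Q ((E x).1.1, k) := by
        intro k
        have hn := hP _ hx
        fin_cases k
        · exact Or.inl rfl
        · exact Or.inr (Or.inl ⟨rfl, hn⟩)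
        · exact Or.inr (Or.inr ⟨rfl, hx⟩)
      have others : ∀ i : Fin 3, ∃ j k : Fin 3, i ≠ j ∧ i ≠ k ∧ j ≠ k := by decide
      obtain ⟨j, k, hij, hik, hjk⟩ := others (E x).1.2
      obtain ⟨y, hy, rfl⟩ := mk _ j (mem j)
      obtain ⟨z, hz, rfl⟩ := mk _ k (mem k)
      exact ⟨y, z, hy.symm, hz.symm, fun h => hij (by rw [h]), fun h => hik (by rw [h]),
        fun h => hjk (by rw [h])⟩

/-- There is an MSO₁ graph interpretation `I = (ν, μ)` and a polynomial `p` such that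
every finite graph `G` with at least `4` vertices is isomorphic to `I(H)` for some unit
interval graph `H` with at most `p(|V(G)|)` vertices.  In particular, the class of all
finite graphs has a polynomially bounded simple MSO₁ interpretation in the class of
unit interval graphs. -/
theorem all_graphs_MSO1_interpretable_in_unit_interval :
    ∃ (ν μ : MSO) (p : Polynomial ℕ),
      ν.FreeVar0 ∧ μ.FreeVar01 ∧ μ.Symm ∧
      ∀ (V : Type) [Fintype V] (G : SimpleGraph V), 4 ≤ Fintype.card V →
        ∃ N : ℕ, N ≤ p.eval (Fintype.card V) ∧
          ∃ (H : SimpleGraph (Fin N)) (ℓ r : Fin N → ℝ),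
            IsIntervalRep H ℓ r ∧ (∀ v, r v - ℓ v = 1) ∧
            Nonempty (G ≃g msoInterpGraph H ν μ) := by
  refine ⟨MSO.vertexFormula, MSO.edgeFormula,
    Polynomial.X * (2 * Polynomial.X ^ 2 + 1) * 3, MSO.vertexFormula_freeVar0,
    MSO.edgeFormula_freeVar01, MSO.edgeFormula_symm, fun V _ G hcard => ?_⟩
  set n := Fintype.card V
  let e : V ≃ Fin n := Fintype.equivFin V
  obtain ⟨N, hN, pos, hlt, hsurj, hfree, hmark⟩ :=
    exists_positions n (n * (2 * n ^ 2 + 1)) (EdgeMark G e) fun _ h => h.le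
  refine ⟨N, by simpa using hN, proximityGraph n pos, _, _,
    proximityGraph_isIntervalRep (by omega) pos, fun v => add_sub_cancel_left _ _,
    nonempty_iso_msoInterpGraph G e ⟨by omega, ?_, hlt, hsurj, fun _ _ => Iff.rfl⟩ hfree hmark⟩
  nlinarith [Nat.mul_le_mul_left n (show 2 ≤ 2 * n ^ 2 + 1 by nlinarith)]
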